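/- Let u : ℝ₊ × ℝ → ℝ be a smooth solution, decaying with its derivatives at spatial infinity, of ∂t(u - α∂xx u) + c∂x u + ε∂xxx u = 0 with α ≥ 0, ε > 0, c ∈ ℝ. Then for any x_ℓ < x_r, d/dt ∫_{x_ℓ}^{x_r} (u² + α(∂x u)²) dx = B(t, x_ℓ) - B(t, x_r), where B(t,x) = c u² + 2ε u ∂xx u - ε(∂x u)² - 2α u ∂²_{xt} u evaluated at (t,x). -/

import Mathlib

open Filter intervalIntegral

lemma aux_dx (f : ℝ → ℝ → ℝ) (hf : ContDiff ℝ (⊤ : ℕ∞) (fun p : ℝ × ℝ => f p.1 p.2)) (t x : ℝ) :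
    HasDerivAt (f t) (fderiv ℝ (fun p : ℝ × ℝ => f p.1 p.2) (t, x) (0, 1)) x := by
  have h1 : HasFDerivAt (fun p : ℝ × ℝ => f p.1 p.2) _ (t, x) :=
    ((hf.differentiable (by simp)) (t, x)).hasFDerivAt
  have h2 : HasDerivAt (fun y : ℝ => ((t, y) : ℝ × ℝ)) (0, 1) x :=
    (hasDerivAt_const x t).prodMk (hasDerivAt_id x)
  exact h1.comp_hasDerivAt x h2

lemma aux_dt (f : ℝ → ℝ → ℝ) (hf : ContDiff ℝ (⊤ : ℕ∞) (fun p : ℝ × ℝ => f p.1 p.2)) (t x : ℝ) :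
    HasDerivAt (fun τ => f τ x) (fderiv ℝ (fun p : ℝ × ℝ => f p.1 p.2) (t, x) (1, 0)) t := by
  have h1 : HasFDerivAt (fun p : ℝ × ℝ => f p.1 p.2) _ (t, x) :=
    ((hf.differentiable (by simp)) (t, x)).hasFDerivAt
  have h2 : HasDerivAt (fun y : ℝ => ((y, x) : ℝ × ℝ)) (1, 0) t :=
    (hasDerivAt_id t).prodMk (hasDerivAt_const t x)
  exact h1.comp_hasDerivAt t h2

lemma aux_smooth (F : ℝ × ℝ → ℝ) (hF : ContDiff ℝ (⊤ : ℕ∞) F) (v : ℝ × ℝ) :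
    ContDiff ℝ (⊤ : ℕ∞) (fun p => fderiv ℝ F p v) :=
  (hF.fderiv_right (m := (⊤ : ℕ∞)) (by simp)).clm_apply contDiff_const

lemma aux_sdx (f : ℝ → ℝ → ℝ) (hf : ContDiff ℝ (⊤ : ℕ∞) (fun p : ℝ × ℝ => f p.1 p.2)) :
    ContDiff ℝ (⊤ : ℕ∞) (fun p : ℝ × ℝ => deriv (f p.1) p.2) := by
  have := aux_smooth _ hf (0, 1)
  convert this using 2 with p
  exact (aux_dx f hf p.1 p.2).deriv

lemma aux_sdt (f : ℝ → ℝ → ℝ) (hf : ContDiff ℝ (⊤ : ℕ∞) (fun p : ℝ × ℝ => f p.1 p.2)) :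
    ContDiff ℝ (⊤ : ℕ∞) (fun p : ℝ × ℝ => deriv (fun τ => f τ p.2) p.1) := by
  have := aux_smooth _ hf (1, 0)
  convert this using 2 with p
  exact (aux_dt f hf p.1 p.2).deriv

lemma aux_comm (f : ℝ → ℝ → ℝ) (hf : ContDiff ℝ (⊤ : ℕ∞) (fun p : ℝ × ℝ => f p.1 p.2)) (t x : ℝ) :
    HasDerivAt (fun y => deriv (fun τ => f τ y) t) (deriv (fun τ => deriv (f τ) x) t) x := by
  have hd := aux_dx (fun t x => deriv (fun τ => f τ x) t) (aux_sdt f hf) t x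
  have hd2 := aux_dt (fun t x => deriv (f t) x) (aux_sdx f hf) t x
  rw [hd2.deriv]
  convert hd using 1
  have e1 : (fun p : ℝ × ℝ => deriv (f p.1) p.2)
      = fun p => fderiv ℝ (fun p : ℝ × ℝ => f p.1 p.2) p (0, 1) := by
    funext p; exact (aux_dx f hf p.1 p.2).deriv
  have e2 : (fun p : ℝ × ℝ => deriv (fun τ => f τ p.2) p.1)
      = fun p => fderiv ℝ (fun p : ℝ × ℝ => f p.1 p.2) p (1, 0) := by
    funext p; exact (aux_dt f hf p.1 p.2).deriv
  rw [e1, e2]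
  have hdd : DifferentiableAt ℝ (fderiv ℝ (fun p : ℝ × ℝ => f p.1 p.2)) (t, x) :=
    ((hf.fderiv_right (m := (⊤ : ℕ∞)) (by simp)).differentiable (by simp)) _
  have hs : IsSymmSndFDerivAt ℝ (fun p : ℝ × ℝ => f p.1 p.2) (t, x) :=
    (hf.contDiffAt).isSymmSndFDerivAt (by
      rw [minSmoothness_of_isRCLikeNormedField]; exact WithTop.coe_le_coe.2 (le_top : (2 : ℕ∞) ≤ ⊤))
  rw [fderiv_clm_apply hdd (by fun_prop), fderiv_clm_apply hdd (by fun_prop)]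
  simpa using hs (1, 0) (0, 1)

lemma aux_param (G : ℝ → ℝ → ℝ) (hG : ContDiff ℝ (⊤ : ℕ∞) (fun p : ℝ × ℝ => G p.1 p.2))
    (a b t : ℝ) : HasDerivAt (fun τ => ∫ x in a..b, G τ x)
      (∫ x in a..b, deriv (fun τ => G τ x) t) t := by
  have hc := (aux_sdt G hG).continuous
  obtain ⟨C, hC⟩ := ((isCompact_closedBall t 1).prod
    (isCompact_uIcc (a := a) (b := b))).exists_bound_of_continuousOn hc.continuousOn
  have hGc : ∀ τ, Continuous (G τ) := fun τ =>
    hG.continuous.comp (Continuous.prodMk_right τ)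
  have hG'c : Continuous (fun x => deriv (fun τ => G τ x) t) :=
    hc.comp (Continuous.prodMk_right t)
  refine (intervalIntegral.hasDerivAt_integral_of_dominated_loc_of_deriv_le
    (F' := fun τ x => deriv (fun τ => G τ x) τ) (bound := fun _ => C)
    (Metric.closedBall_mem_nhds t one_pos)
    (Eventually.of_forall fun τ => (hGc τ).aestronglyMeasurable)
    ((hGc t).intervalIntegrable _ _) hG'c.aestronglyMeasurable
    (Eventually.of_forall fun x hx τ hτ => hC (τ, x) ⟨hτ, Set.uIoc_subset_uIcc hx⟩)
    intervalIntegrable_const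
    (Eventually.of_forall fun x hx τ hτ => ?_)).2
  exact (aux_dt G hG τ x).differentiableAt.hasDerivAt

/-- H¹-energy balance for smooth decaying solutions of the linearized KdV-BBM equation:
`d/dt ∫_{x_ℓ}^{x_r} (u² + α(∂x u)²) dx = B(t,x_ℓ) - B(t,x_r)` with boundary flux
`B = cu² + 2εu∂xxu - ε(∂xu)² - 2αu∂²_{xt}u`. -/
theorem stmt_13 (α ε c : ℝ) (hα : 0 ≤ α) (hε : 0 < ε) (u : ℝ → ℝ → ℝ)
    (hsmooth : ContDiff ℝ (⊤ : ℕ∞) (fun p : ℝ × ℝ => u p.1 p.2))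
    (hdecay : ∀ t : ℝ,
      Tendsto (fun x => u t x) atTop (nhds 0) ∧ Tendsto (fun x => u t x) atBot (nhds 0) ∧
      Tendsto (fun x => deriv (u t) x) atTop (nhds 0) ∧
      Tendsto (fun x => deriv (u t) x) atBot (nhds 0) ∧
      Tendsto (fun x => deriv (deriv (u t)) x) atTop (nhds 0) ∧
      Tendsto (fun x => deriv (deriv (u t)) x) atBot (nhds 0))
    (hpde : ∀ t x : ℝ,
      deriv (fun τ => u τ x) t - α * deriv (fun τ => deriv (deriv (u τ)) x) t
        + c * deriv (u t) x + ε * deriv (deriv (deriv (u t))) x = 0)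
    (xl xr : ℝ) (hlr : xl < xr) :
    let B : ℝ → ℝ → ℝ := fun t x =>
      c * (u t x) ^ 2 + 2 * ε * u t x * deriv (deriv (u t)) x
        - ε * (deriv (u t) x) ^ 2 - 2 * α * u t x * deriv (fun τ => deriv (u τ) x) t
    ∀ t : ℝ, 0 < t →
      HasDerivAt (fun τ => ∫ x in xl..xr, ((u τ x) ^ 2 + α * (deriv (u τ) x) ^ 2))
        (B t xl - B t xr) t := by
  intro B t _
  have s1 := aux_sdx u hsmooth
  have s2 := aux_sdx (fun t x => deriv (u t) x) s1
  have hG : ContDiff ℝ (⊤ : ℕ∞)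
      (fun p : ℝ × ℝ => (u p.1 p.2) ^ 2 + α * (deriv (u p.1) p.2) ^ 2) :=
    (hsmooth.pow 2).add (contDiff_const.mul (s1.pow 2))
  have hP := aux_param (fun τ x => (u τ x) ^ 2 + α * (deriv (u τ) x) ^ 2) hG xl xr t
  convert hP using 1
  have hc : Continuous (fun x => deriv (fun τ => (u τ x) ^ 2 + α * (deriv (u τ) x) ^ 2) t) :=
    (aux_sdt (fun τ x => (u τ x) ^ 2 + α * (deriv (u τ) x) ^ 2) hG).continuous.comp
      (Continuous.prodMk_right t)
  have key : ∀ x, HasDerivAt (fun x => - B t x)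
      (deriv (fun τ => (u τ x) ^ 2 + α * (deriv (u τ) x) ^ 2) t) x := by
    intro x
    have h0 : HasDerivAt (u t) (deriv (u t) x) x :=
      (aux_dx u hsmooth t x).differentiableAt.hasDerivAt
    have h1 : HasDerivAt (fun x => deriv (u t) x) (deriv (deriv (u t)) x) x :=
      (aux_dx (fun t x => deriv (u t) x) s1 t x).differentiableAt.hasDerivAt
    have h2 : HasDerivAt (fun x => deriv (deriv (u t)) x) (deriv (deriv (deriv (u t))) x) x :=
      (aux_dx (fun t x => deriv (deriv (u t)) x) s2 t x).differentiableAt.hasDerivAt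
    have h3 := aux_comm (fun t x => deriv (u t) x) s1 t x
    have g0 : HasDerivAt (fun τ => u τ x) (deriv (fun τ => u τ x) t) t :=
      (aux_dt u hsmooth t x).differentiableAt.hasDerivAt
    have g1 : HasDerivAt (fun τ => deriv (u τ) x) (deriv (fun τ => deriv (u τ) x) t) t :=
      (aux_dt (fun t x => deriv (u t) x) s1 t x).differentiableAt.hasDerivAt
    have hE := ((g0.fun_pow 2).fun_add ((g1.fun_pow 2).const_mul α)).deriv
    rw [hE]
    have hB := (((((h0.fun_pow 2).const_mul c).fun_add
      ((h0.const_mul (2 * ε)).fun_mul h2)).fun_sub ((h1.fun_pow 2).const_mul ε)).fun_sub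
      ((h0.const_mul (2 * α)).fun_mul h3)).fun_neg
    refine hB.congr_deriv ?_
    have := hpde t x
    push_cast
    linear_combination (-2 * u t x) * this
  rw [integral_eq_sub_of_hasDerivAt (fun x _ => key x) (hc.intervalIntegrable _ _)]
  ring
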